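/- arXiv:0909.2524 — 2 statements merged into one kernel-verified Lean document; each statement's English description precedes it below -/
import Mathlib

section
/- Let X be the subset of the plane consisting of the open upper half-plane together with the two points (0,0) and (1,0), i.e. X = {(a,b) ∈ ℝ² : b > 0} ∪ {(0,0), (1,0)}, with the Euclidean metric. In the race-to-a-point game on X with both players starting at (1,0) and target (0,0), both players have winning strategies. -/
/-!
Race to a point on the open upper half-plane together with (0,0) and (1,0): starting
at (1,0) with target (0,0), both players have winning strategies.
-/

open NNReal ENNReal

noncomputable section

abbrev E2 := EuclideanSpace ℝ (Fin 2)

/-- The point `(a, b)` of the Euclidean plane. -/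
def ptE (a b : ℝ) : E2 := (WithLp.equiv 2 (Fin 2 → ℝ)).symm ![a, b]

/-- The open upper half-plane together with the two points `(0,0)` and `(1,0)`. -/
def HalfPlanePlus : Set E2 := {p : E2 | 0 < p 1} ∪ {ptE 0 0, ptE 1 0}

/-- A (speed at most 1) path in `S ⊆ E`, starting at `x`, defined on `[0,∞)`. -/
def IsPathIn {E : Type*} [MetricSpace E] (S : Set E) (x : E) (f : ℝ≥0 → E) : Prop :=
  f 0 = x ∧ LipschitzWith 1 f ∧ ∀ t, f t ∈ S

/-- The first time a path `p` reaches the point `z` (`∞` if it never does). -/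
def reachTime {E : Type*} [MetricSpace E] (z : E) (p : ℝ≥0 → E) : ℝ≥0∞ :=
  ⨅ t ∈ {t : ℝ≥0 | p t = z}, (t : ℝ≥0∞)

/-- A strategy for the player starting at `xSelf`, responding to paths of the opponent
who starts at `xOpp`, both confined to `S`: a no-lookahead map from opponent paths to
own paths. -/
def IsRaceStrategyIn {E : Type*} [MetricSpace E] (S : Set E) (xOpp xSelf : E)
    (Φ : (ℝ≥0 → E) → (ℝ≥0 → E)) : Prop :=
  (∀ b, IsPathIn S xOpp b → IsPathIn S xSelf (Φ b)) ∧
  ∀ b b', IsPathIn S xOpp b → IsPathIn S xOpp b' → ∀ t : ℝ≥0,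
    (∀ s ≤ t, b s = b' s) → ∀ s ≤ t, Φ b s = Φ b' s

@[simp] lemma ptE_apply_zero (a b : ℝ) : ptE a b 0 = a := by simp [ptE]

@[simp] lemma ptE_apply_one (a b : ℝ) : ptE a b 1 = b := by simp [ptE]

lemma dist_ptE_le (a b c d : ℝ) : dist (ptE a b) (ptE c d) ≤ |a - c| + |b - d| := by
  rw [EuclideanSpace.dist_eq, Fin.sum_univ_two]
  simp only [ptE_apply_zero, ptE_apply_one, Real.dist_eq]
  refine Real.sqrt_le_iff.2 ⟨by positivity, ?_⟩
  nlinarith [abs_nonneg (a - c), abs_nonneg (b - d)]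

/-- The time lost so far, in the horizontal direction, by a path `b` from `(1,0)`. -/
def timeLoss (b : ℝ≥0 → E2) (t : ℝ≥0) : ℝ := t - 1 + b t 0

/-- Run to the left, losing one eighth of the opponent's loss and using it as height; once above
the origin, descend. -/
def raceResponse (b : ℝ≥0 → E2) (t : ℝ≥0) : E2 :=
  ptE (max (1 - t + timeLoss b t / 8) 0)
    (max (timeLoss b t / 8 + min (1 - t + timeLoss b t / 8) 0) 0)

section Path

variable {b : ℝ≥0 → E2}

lemma IsPathIn.dist_sq_le {S : Set E2} {x : E2} (hb : IsPathIn S x b) {s t : ℝ≥0} (hst : s ≤ t) :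
    (b t 0 - b s 0) ^ 2 + (b t 1 - b s 1) ^ 2 ≤ ((t : ℝ) - s) ^ 2 := by
  have hst' : (s : ℝ) ≤ t := hst
  have h := hb.2.1.dist_le_mul t s
  rw [NNReal.coe_one, one_mul, NNReal.dist_eq, abs_of_nonneg (sub_nonneg.2 hst'),
    EuclideanSpace.dist_eq, Fin.sum_univ_two, Real.sqrt_le_left (sub_nonneg.2 hst')] at h
  simpa only [Real.dist_eq, sq_abs] using h

lemma IsPathIn.timeLoss_mono {S : Set E2} {x : E2} (hb : IsPathIn S x b) {s t : ℝ≥0}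
    (hst : s ≤ t) : timeLoss b s ≤ timeLoss b t := by
  have hst' : (s : ℝ) ≤ t := hst
  have := (abs_le_of_sq_le_sq' (by nlinarith [hb.dist_sq_le hst, sq_nonneg (b t 1 - b s 1)])
    (sub_nonneg.2 hst') : _ ≤ b t 0 - b s 0 ∧ _)
  unfold timeLoss
  linarith [this.1]

lemma IsPathIn.timeLoss_sub_le {S : Set E2} {x : E2} (hb : IsPathIn S x b) {s t : ℝ≥0}
    (hst : s ≤ t) : timeLoss b t - timeLoss b s ≤ 2 * ((t : ℝ) - s) := by
  have hst' : (s : ℝ) ≤ t := hst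
  have := (abs_le_of_sq_le_sq' (by nlinarith [hb.dist_sq_le hst, sq_nonneg (b t 1 - b s 1)])
    (sub_nonneg.2 hst') : _ ≤ b t 0 - b s 0 ∧ _)
  unfold timeLoss
  linarith [this.2]

lemma IsPathIn.timeLoss_zero {S : Set E2} (hb : IsPathIn S (ptE 1 0) b) : timeLoss b 0 = 0 := by
  simp [timeLoss, hb.1]

lemma IsPathIn.timeLoss_pos (hb : IsPathIn HalfPlanePlus (ptE 1 0) b) {t : ℝ≥0} (ht : 0 < t) :
    0 < timeLoss b t := by
  refine lt_of_lt_of_le ?_ (hb.timeLoss_mono (min_le_left t (1 / 2)))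
  set s : ℝ≥0 := min t (1 / 2)
  have hs0 : (0 : ℝ) < s := NNReal.coe_pos.2 (lt_min ht (by norm_num))
  have hs1 : (s : ℝ) ≤ 1 / 2 := by
    have : s ≤ 1 / 2 := min_le_right _ _
    exact_mod_cast this
  have hd := hb.dist_sq_le (zero_le : 0 ≤ s)
  simp only [hb.1, ptE_apply_zero, ptE_apply_one, NNReal.coe_zero, sub_zero] at hd
  unfold timeLoss
  rcases hb.2.2 s with h | h | h
  · have h : 0 < b s 1 := h
    nlinarith [pow_pos h 2]
  · simp only [h, ptE_apply_zero, ptE_apply_one] at hd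
    nlinarith
  · simpa [show b s = ptE 1 0 from h] using hs0

lemma raceResponse_eq_origin {t : ℝ≥0} (h0 : 0 ≤ timeLoss b t)
    (h : 1 - t + timeLoss b t / 4 ≤ 0) : raceResponse b t = ptE 0 0 := by
  have hw : 1 - (t : ℝ) + timeLoss b t / 8 ≤ 0 := by linarith
  unfold raceResponse
  rw [max_eq_right hw, min_eq_left hw, max_eq_right (by linarith)]

lemma dist_raceResponse_le {S : Set E2} {x : E2} (hb : IsPathIn S x b) {s t : ℝ≥0}
    (hst : s ≤ t) : dist (raceResponse b s) (raceResponse b t) ≤ (t : ℝ) - s := by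
  have h1 := hb.timeLoss_mono hst
  have h2 := hb.timeLoss_sub_le hst
  refine (dist_ptE_le _ _ _ _).trans ?_
  generalize timeLoss b s = e at *
  generalize timeLoss b t = f at *
  have hw : 1 - (t : ℝ) + f / 8 ≤ 1 - s + e / 8 := by linarith
  have hv : |max (e / 8 + min (1 - (s : ℝ) + e / 8) 0) 0 -
        max (f / 8 + min (1 - (t : ℝ) + f / 8) 0) 0|
      ≤ |(e / 8 + min (1 - (s : ℝ) + e / 8) 0) - (f / 8 + min (1 - (t : ℝ) + f / 8) 0)| :=
    abs_max_sub_max_le_abs _ _ _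
  have hx := max_add_min (1 - (s : ℝ) + e / 8) 0
  have hy := max_add_min (1 - (t : ℝ) + f / 8) 0
  have hmax := max_le_max_right 0 hw
  have hmin := min_le_min_right 0 hw
  rw [abs_of_nonneg (sub_nonneg.2 hmax)]
  refine (add_le_add_right hv _).trans ?_
  rw [← le_sub_iff_add_le', abs_le]
  constructor <;> linarith

lemma isPathIn_raceResponse (hb : IsPathIn HalfPlanePlus (ptE 1 0) b) :
    IsPathIn HalfPlanePlus (ptE 1 0) (raceResponse b) := by
  have h0 : raceResponse b 0 = ptE 1 0 := by simp [raceResponse, hb.timeLoss_zero]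
  refine ⟨h0, LipschitzWith.of_dist_le_mul fun s t => ?_, fun t => ?_⟩
  · rw [NNReal.coe_one, one_mul, NNReal.dist_eq]
    rcases le_total s t with h | h
    · rw [abs_sub_comm]
      exact (dist_raceResponse_le hb h).trans (le_abs_self _)
    · rw [dist_comm]
      exact (dist_raceResponse_le hb h).trans (le_abs_self _)
  · rcases eq_zero_or_pos t with rfl | ht
    · exact h0 ▸ Or.inr (Or.inr rfl)
    have he := hb.timeLoss_pos ht
    by_cases h : 1 - t + timeLoss b t / 4 ≤ 0
    · exact Or.inr (Or.inl (raceResponse_eq_origin he.le h))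
    · left
      simp only [raceResponse, Set.mem_ofPred_eq, ptE_apply_one]
      refine lt_max_of_lt_left ?_
      rcases min_choice (1 - (t : ℝ) + timeLoss b t / 8) 0 with h' | h' <;> rw [h'] <;> linarith

lemma exists_lt_raceResponse_eq_origin (hb : IsPathIn HalfPlanePlus (ptE 1 0) b) {t : ℝ≥0}
    (ht : b t = ptE 0 0) : ∃ s < t, raceResponse b s = ptE 0 0 := by
  have hpos : 0 < t := by
    refine pos_iff_ne_zero.2 fun h => ?_
    have := congrArg (fun p : E2 => p 0) (hb.1.symm.trans (h ▸ ht))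
    simp at this
  have he := hb.timeLoss_pos hpos
  have het : timeLoss b t = t - 1 := by simp [timeLoss, ht]
  have hst : (t + 3) / 4 < t := by
    rw [← NNReal.coe_lt_coe]
    push_cast
    linarith
  have hm := hb.timeLoss_mono hst.le
  refine ⟨(t + 3) / 4, hst, raceResponse_eq_origin (hb.timeLoss_pos (by positivity)).le ?_⟩
  push_cast
  linarith

lemma reachTime_le {z : E2} {t : ℝ≥0} (h : b t = z) : reachTime z b ≤ t :=
  iInf₂_le t h

lemma reachTime_raceResponse_lt (hb : IsPathIn HalfPlanePlus (ptE 1 0) b) :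
    reachTime (ptE 0 0) (raceResponse b) < reachTime (ptE 0 0) b := by
  by_cases hne : {t : ℝ≥0 | b t = ptE 0 0}.Nonempty
  · have hmem : sInf {t : ℝ≥0 | b t = ptE 0 0} ∈ {t : ℝ≥0 | b t = ptE 0 0} :=
      (isClosed_eq hb.2.1.continuous continuous_const).csInf_mem hne (OrderBot.bddBelow _)
    obtain ⟨s, hs, hs'⟩ := exists_lt_raceResponse_eq_origin hb hmem
    refine (reachTime_le hs').trans_lt ((ENNReal.coe_lt_coe.2 hs).trans_le ?_)
    exact le_iInf₂ fun t ht => ENNReal.coe_le_coe.2 (csInf_le (OrderBot.bddBelow _) ht)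
  · have h2 : raceResponse b 2 = ptE 0 0 := by
      refine raceResponse_eq_origin (hb.timeLoss_pos (by norm_num)).le ?_
      have := hb.timeLoss_sub_le (zero_le : (0 : ℝ≥0) ≤ 2)
      rw [hb.timeLoss_zero] at this
      push_cast at this ⊢
      linarith
    refine (reachTime_le h2).trans_lt (ENNReal.coe_lt_top.trans_le ?_)
    exact le_iInf₂ fun t ht => (hne ⟨t, ht⟩).elim

end Path

lemma isRaceStrategyIn_raceResponse :
    IsRaceStrategyIn HalfPlanePlus (ptE 1 0) (ptE 1 0) raceResponse :=
  ⟨fun _ => isPathIn_raceResponse, fun b b' _ _ t h s hs => by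
    simp only [raceResponse, timeLoss, h s hs]⟩

/-- In the race-to-a-point game on the open upper half-plane together with `(0,0)` and
`(1,0)`, with both players starting at `(1,0)` and racing to `(0,0)`, both players
have winning strategies. -/
theorem race_to_point_both_win :
    (∃ Φ, IsRaceStrategyIn HalfPlanePlus (ptE 1 0) (ptE 1 0) Φ ∧
      ∀ b, IsPathIn HalfPlanePlus (ptE 1 0) b →
        reachTime (ptE 0 0) (Φ b) < reachTime (ptE 0 0) b) ∧
    (∃ Ψ, IsRaceStrategyIn HalfPlanePlus (ptE 1 0) (ptE 1 0) Ψ ∧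
      ∀ a, IsPathIn HalfPlanePlus (ptE 1 0) a →
        reachTime (ptE 0 0) (Ψ a) < reachTime (ptE 0 0) a) := by
  have h := And.intro isRaceStrategyIn_raceResponse fun b => reachTime_raceResponse_lt (b := b)
  exact ⟨⟨raceResponse, h⟩, ⟨raceResponse, h⟩⟩

end
end

section
/- There exists a metric space Y with specified starting points y₁, y₂ for two lions and y_M for the man such that in the two-lions-versus-one-man pursuit game on Y neither side has a winning strategy: for every lion-team strategy there is a consistent play in which the man is never caught, and for every man strategy there is a consistent play in which some lion catches the man. -/
/-!
There is a metric space in which, for the game of two lions versus one man (with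
specified starting positions), neither side has a winning strategy.
-/

open NNReal

noncomputable section

/-- A (speed at most 1) path in `Y` starting at `y`, defined on `[0,∞)`. -/
def IsPath {Y : Type*} [MetricSpace Y] (y : Y) (f : ℝ≥0 → Y) : Prop :=
  f 0 = y ∧ LipschitzWith 1 f

/-- A strategy for the team of two lions starting at `y₁`, `y₂` against a man starting
at `yM`: a no-lookahead map from man paths to pairs of lion paths. -/
def IsLionTeamStrategy {Y : Type*} [MetricSpace Y] (y₁ y₂ yM : Y)
    (Φ : (ℝ≥0 → Y) → (ℝ≥0 → Y) × (ℝ≥0 → Y)) : Prop :=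
  (∀ m, IsPath yM m → IsPath y₁ (Φ m).1 ∧ IsPath y₂ (Φ m).2) ∧
  ∀ m m', IsPath yM m → IsPath yM m' → ∀ t : ℝ≥0,
    (∀ s ≤ t, m s = m' s) →
    ∀ s ≤ t, (Φ m).1 s = (Φ m').1 s ∧ (Φ m).2 s = (Φ m').2 s

/-- A man strategy against a team of two lions: a no-lookahead map from pairs of lion
paths to man paths. -/
def IsManStrategyVsTwo {Y : Type*} [MetricSpace Y] (y₁ y₂ yM : Y)
    (Ψ : (ℝ≥0 → Y) × (ℝ≥0 → Y) → (ℝ≥0 → Y)) : Prop :=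
  (∀ l : (ℝ≥0 → Y) × (ℝ≥0 → Y), IsPath y₁ l.1 → IsPath y₂ l.2 → IsPath yM (Ψ l)) ∧
  ∀ l l' : (ℝ≥0 → Y) × (ℝ≥0 → Y), IsPath y₁ l.1 → IsPath y₂ l.2 →
    IsPath y₁ l'.1 → IsPath y₂ l'.2 → ∀ t : ℝ≥0,
    (∀ s ≤ t, l.1 s = l'.1 s ∧ l.2 s = l'.2 s) → ∀ s ≤ t, Ψ l s = Ψ l' s

/-- Neither side has a winning strategy in the two-lions-versus-man game on `Y` with
starting points `y₁`, `y₂` (lions) and `yM` (man): for every lion-team strategy there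
is a consistent play in which the man is never caught, and for every man strategy
there is a consistent play in which some lion catches the man. -/
def TwoLionsNoWinner (Y : Type) [MetricSpace Y] (y₁ y₂ yM : Y) : Prop :=
  (∀ Φ, IsLionTeamStrategy y₁ y₂ yM Φ →
    ∃ m, IsPath yM m ∧ ∀ t : ℝ≥0, (Φ m).1 t ≠ m t ∧ (Φ m).2 t ≠ m t) ∧
  (∀ Ψ, IsManStrategyVsTwo y₁ y₂ yM Ψ →
    ∃ l : (ℝ≥0 → Y) × (ℝ≥0 → Y), IsPath y₁ l.1 ∧ IsPath y₂ l.2 ∧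
      ∃ t : ℝ≥0, Ψ l t = l.1 t ∨ Ψ l t = l.2 t)

/-- Positions on the spine of comb `i` that carry a tooth: positive rational numbers for the man's
comb (`i = false`), positive irrational numbers for the lion's comb (`i = true`). -/
def HasTooth (i : Bool) (x : ℝ) : Prop := 0 < x ∧ (Irrational x ↔ i = true)

/-- Two combs and a ray, glued together at the origin `ray 0` of the ray. The point `comb i x h`
lies on comb `i` at height `h` over the spine point `x`; the tooth over `x` has length `1 - x / 2`
and its top is the origin of the ray. -/
inductive Net : Type
  | ray (r : ℝ) (hr : 0 ≤ r) : Net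
  | comb (i : Bool) (x h : ℝ) (hx : -1 ≤ x ∧ x ≤ 1 ∧ 0 ≤ h ∧ h < 1 - x / 2)
      (hT : h = 0 ∨ HasTooth i x) : Net

/-- Labels of the real-valued coordinates on `Net`. -/
inductive Coord : Type
  | depth : Coord
  | side : Coord
  | tooth (i : Bool) (x : ℝ) : Coord

instance : TopologicalSpace Coord := ⊥

instance : DiscreteTopology Coord := ⟨rfl⟩

/-- The sign distinguishing the two combs. -/
def combSign (i : Bool) : ℝ := if i then 1 else -1

lemma combSign_cases (i : Bool) : combSign i = 1 ∨ combSign i = -1 := by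
  cases i <;> simp [combSign]

namespace Net

/-- The coordinates on `Net`. The depth is the signed distance to the origin of the ray, and the
coordinate `tooth i y` is positive exactly on the open tooth over `y`. -/
def coord : Coord → Net → ℝ
  | .depth, ray r _ => -r
  | .depth, comb _ x h _ _ => 1 - x / 2 - h
  | .side, ray _ _ => 0
  | .side, comb i x h _ _ => combSign i * ((x + 2) * (1 - x / 2 - h) / 3)
  | .tooth _ _, ray r _ => -r
  | .tooth j y, comb i x h _ _ =>
      if i = j then
        if x = y then min h (1 - x / 2 - h) else -min (|x - y| + h) (1 - x / 2 - h)
      else -(1 - x / 2 - h)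

lemma abs_coord_le (k : Coord) (p : Net) :
    ‖coord k p‖ ≤ |coord .depth p| + |coord .side p| := by
  rw [Real.norm_eq_abs]
  cases k with
  | depth => linarith [abs_nonneg (coord .side p)]
  | side => linarith [abs_nonneg (coord .depth p)]
  | tooth j y =>
    refine le_trans ?_ (le_add_of_nonneg_right (abs_nonneg _))
    cases p with
    | ray r hr => simp [coord]
    | comb i x h hx hT =>
      obtain ⟨-, -, h0, h1⟩ := hx
      simp only [coord]
      rw [abs_of_pos (a := 1 - x / 2 - h) (by linarith), abs_le]
      have := abs_nonneg (x - y)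
      split_ifs <;> constructor <;> grind

/-- All coordinates of a point of `Net`, as a bounded function. -/
def coords (p : Net) : BoundedContinuousFunction Coord ℝ :=
  BoundedContinuousFunction.ofNormedAddCommGroupDiscrete (fun k => coord k p) _
    (fun k => abs_coord_le k p)

lemma coords_injective : Function.Injective coords := by
  intro p q hpq
  have key : ∀ k, coord k p = coord k q := fun k => DFunLike.congr_fun hpq k
  cases p with
  | ray r hr =>
    cases q with
    | ray r' hr' =>
      have := key .depth
      simp only [coord] at this
      simpa using this
    | comb i x h hx hT =>
      have := key .depth
      simp only [coord] at this
      linarith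
  | comb i x h hx hT =>
    cases q with
    | ray r' hr' =>
      have := key .depth
      simp only [coord] at this
      linarith
    | comb j y g hy hT' =>
      have h1 := key .depth
      have h2 := key (.tooth i x)
      have h3 := key (.tooth j y)
      simp only [coord] at h1 h2 h3
      have hxy := abs_nonneg (y - x)
      have hxy' : y ≠ x → 0 < |y - x| := fun h => abs_pos.2 (sub_ne_zero.2 h)
      have hij : i = j := by grind
      have hx' : x = y := by grind
      subst hij hx'
      have : h = g := by linarith
      subst this
      rfl

instance : MetricSpace Net := MetricSpace.induced coords coords_injective inferInstance

lemma coord_sub_le_dist (k : Coord) (p q : Net) : |coord k p - coord k q| ≤ dist p q :=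
  BoundedContinuousFunction.dist_coe_le_dist (f := coords p) (g := coords q) k

lemma dist_le_of_coord {p q : Net} {C : ℝ} (hC : 0 ≤ C)
    (h : ∀ k, |coord k p - coord k q| ≤ C) : dist p q ≤ C :=
  (BoundedContinuousFunction.dist_le (f := coords p) (g := coords q) hC).2 h

/-- A curve in `Net` parametrized by the real line with speed at most one. -/
def Slow (l : ℝ → Net) : Prop := ∀ k s t, |coord k (l s) - coord k (l t)| ≤ |s - t|

lemma Slow.continuous {l : ℝ → Net} (hl : Slow l) (k : Coord) :
    Continuous fun t => coord k (l t) := by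
  refine (LipschitzWith.of_dist_le_mul (K := 1) fun s t => ?_).continuous
  simpa [Real.dist_eq] using hl k s t

lemma Slow.le {l : ℝ → Net} (hl : Slow l) (k : Coord) {s t : ℝ} (h : s ≤ t) :
    |coord k (l t) - coord k (l s)| ≤ t - s := by
  simpa [abs_of_nonneg (sub_nonneg.2 h)] using hl k t s

lemma _root_.IsPath.slow {y : Net} {m : ℝ≥0 → Net} (hm : IsPath y m) :
    Slow fun t : ℝ => m t.toNNReal := by
  intro k s t
  refine (coord_sub_le_dist k _ _).trans ((hm.2.dist_le_mul _ _).trans ?_)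
  rw [NNReal.coe_one, one_mul, NNReal.dist_eq, Real.coe_toNNReal', Real.coe_toNNReal']
  exact abs_max_sub_max_le_abs s t 0

lemma Slow.isPath {l : ℝ → Net} (hl : Slow l) : IsPath (l 0) fun t : ℝ≥0 => l t := by
  refine ⟨by simp, LipschitzWith.of_dist_le_mul fun s t => ?_⟩
  rw [NNReal.coe_one, one_mul, NNReal.dist_eq]
  exact dist_le_of_coord (abs_nonneg _) fun k => hl k s t

lemma exists_eq_zero {f : ℝ → ℝ} (hf : Continuous f) {a b : ℝ} (hab : a ≤ b)
    (h : f a * f b ≤ 0) : ∃ z, a ≤ z ∧ z ≤ b ∧ f z = 0 := by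
  rcases le_total (f a) 0 with ha | ha
  · rcases le_total 0 (f b) with hb | hb
    · obtain ⟨z, hz, h0⟩ := intermediate_value_Icc hab hf.continuousOn ⟨ha, hb⟩
      exact ⟨z, hz.1, hz.2, h0⟩
    · rcases mul_eq_zero.1 (le_antisymm h (mul_nonneg_of_nonpos_of_nonpos ha hb)) with h | h
      · exact ⟨a, le_rfl, hab, h⟩
      · exact ⟨b, hab, le_rfl, h⟩
  · rcases le_total (f b) 0 with hb | hb
    · obtain ⟨z, hz, h0⟩ := intermediate_value_Icc' hab hf.continuousOn ⟨hb, ha⟩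
      exact ⟨z, hz.1, hz.2, h0⟩
    · rcases mul_eq_zero.1 (le_antisymm h (mul_nonneg ha hb)) with h | h
      · exact ⟨a, le_rfl, hab, h⟩
      · exact ⟨b, hab, le_rfl, h⟩

/-- The point of the spine of comb `i` at position `s`, clamped to `[-1, 1]`. -/
def spine (i : Bool) (s : ℝ) : Net :=
  comb i (max (-1) (min 1 s)) 0
    (by have := min_le_left 1 s
        exact ⟨le_max_left _ _, max_le (by norm_num) this, le_rfl,
          by have := max_le (c := 1) (by norm_num : (-1 : ℝ) ≤ 1) this; linarith⟩)
    (Or.inl rfl)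

lemma spine_eq {i : Bool} {s : ℝ} (h : -1 ≤ s ∧ s ≤ 1 ∧ (0 : ℝ) ≤ 0 ∧ 0 < 1 - s / 2) :
    spine i s = comb i s 0 h (Or.inl rfl) := by
  simp [spine, h.1, h.2.1]

lemma coord_spine_sub_le (k : Coord) (i : Bool) (s t : ℝ) :
    |coord k (spine i s) - coord k (spine i t)| ≤ |s - t| := by
  have key : |max (-1) (min 1 s) - max (-1) (min 1 t)| ≤ |s - t| := by
    grind
  refine le_trans ?_ key
  have hs : -1 ≤ max (-1) (min 1 s) ∧ max (-1) (min 1 s) ≤ 1 := by grind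
  have ht : -1 ≤ max (-1) (min 1 t) ∧ max (-1) (min 1 t) ≤ 1 := by grind
  simp only [spine]
  cases k with
  | depth =>
    simp only [coord]
    generalize max (-1) (min 1 s) = x at *
    generalize max (-1) (min 1 t) = y at *
    grind
  | side =>
    simp only [coord]
    generalize max (-1) (min 1 s) = x at *
    generalize max (-1) (min 1 t) = y at *
    rw [← mul_sub, abs_mul]
    have : |combSign i| = 1 := by rcases combSign_cases i with h | h <;> simp [h]
    rw [this, one_mul]
    have e : (x + 2) * (1 - x / 2 - 0) / 3 - (y + 2) * (1 - y / 2 - 0) / 3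
        = (x - y) * (-(x + y) / 6) := by ring
    rw [e, abs_mul]
    refine mul_le_of_le_one_right (abs_nonneg _) (abs_le.2 ⟨?_, ?_⟩) <;> linarith
  | tooth j z =>
    simp only [coord]
    generalize max (-1) (min 1 s) = x at *
    generalize max (-1) (min 1 t) = y at *
    grind

lemma coord_comb_sub_le (k : Coord) {i : Bool} {x h h' : ℝ} (hx hT hx' hT') :
    |coord k (comb i x h hx hT) - coord k (comb i x h' hx' hT')| ≤ |h - h'| := by
  cases k with
  | depth => simp only [coord]; grind
  | side =>
    simp only [coord]
    rw [← mul_sub, abs_mul]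
    have : |combSign i| = 1 := by rcases combSign_cases i with h | h <;> simp [h]
    rw [this, one_mul]
    have e : (x + 2) * (1 - x / 2 - h) / 3 - (x + 2) * (1 - x / 2 - h') / 3
        = (h - h') * (-(x + 2) / 3) := by ring
    rw [e, abs_mul]
    refine mul_le_of_le_one_right (abs_nonneg _) (abs_le.2 ⟨?_, ?_⟩) <;> linarith
  | tooth j z => simp only [coord]; grind

lemma coord_comb_sub_ray_le (k : Coord) {i : Bool} {x h : ℝ} (hx hT hr) :
    |coord k (comb i x h hx hT) - coord k (ray 0 hr)| ≤ 1 - x / 2 - h := by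
  cases k with
  | depth => simp only [coord]; grind
  | side =>
    simp only [coord]
    rw [sub_zero, abs_mul]
    have : |combSign i| = 1 := by rcases combSign_cases i with h | h <;> simp [h]
    rw [this, one_mul, abs_le]
    constructor <;> nlinarith
  | tooth j z => simp only [coord]; grind

lemma coord_ray_sub_le (k : Coord) {r r' : ℝ} (hr hr') :
    |coord k (ray r hr) - coord k (ray r' hr')| ≤ |r - r'| := by
  cases k <;> simp only [coord] <;> grind

/-- Follow the spine of comb `i` up to `c`, climb the tooth over `c`, then move on along the ray
with speed `v`. -/
def climb (i : Bool) (c : ℝ) (hc : HasTooth i c ∧ c ≤ 1) (v : ℝ≥0) (s : ℝ) : Net :=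
  if s ≤ c then spine i s
  else if h : c < s ∧ s < 1 + c / 2 then
    comb i c (s - c)
      ⟨by linarith [hc.1.1], hc.2, by linarith [h.1], by linarith [h.2]⟩ (Or.inr hc.1)
  else ray (v * max 0 (s - (1 + c / 2))) (by positivity)

lemma climb_of_le {i : Bool} {c : ℝ} (hc) {v : ℝ≥0} {s : ℝ} (h : s ≤ c) :
    climb i c hc v s = spine i s := if_pos h

lemma climb_of_lt {i : Bool} {c : ℝ} (hc) {v : ℝ≥0} {s : ℝ} (h : c ≤ s) (h' : s < 1 + c / 2) :
    climb i c hc v s = comb i c (s - c)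
      ⟨by linarith [hc.1.1], hc.2, by linarith, by linarith⟩ (Or.inr hc.1) := by
  rcases h.eq_or_lt with rfl | h
  · rw [climb_of_le hc le_rfl,
      spine_eq ⟨by linarith [hc.1.1], hc.2, le_rfl, by linarith [hc.2]⟩]
    simp
  · rw [climb, if_neg (not_le.2 h), dif_pos ⟨h, h'⟩]

lemma climb_of_ge {i : Bool} {c : ℝ} (hc) {v : ℝ≥0} {s : ℝ} (h : 1 + c / 2 ≤ s) :
    climb i c hc v s = ray (v * (s - (1 + c / 2))) (mul_nonneg v.2 (by linarith)) := by
  rw [climb, if_neg (by linarith [hc.2]), dif_neg (fun h' => by linarith [h'.2])]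
  simp [max_eq_right (sub_nonneg.2 h)]

lemma slow_spine (i : Bool) (a : ℝ) : Slow fun t => spine i (a + t) := by
  intro k s t
  simpa using coord_spine_sub_le k i (a + s) (a + t)

lemma slow_climb {i : Bool} {c : ℝ} (hc) {v : ℝ≥0} (hv : v ≤ 1) (a : ℝ) :
    Slow fun t => climb i c hc v (a + t) := by
  have hv' : (v : ℝ) ≤ 1 := hv
  have h1 : ∀ k s t, s ≤ t → t ≤ c →
      |coord k (climb i c hc v s) - coord k (climb i c hc v t)| ≤ t - s := by
    intro k s t hst ht
    rw [climb_of_le hc ht, climb_of_le hc (hst.trans ht), ← abs_of_nonneg (sub_nonneg.2 hst),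
      abs_sub_comm t s]
    exact coord_spine_sub_le k i s t
  have h2 : ∀ k s t, s ≤ t → c ≤ s → t ≤ 1 + c / 2 →
      |coord k (climb i c hc v s) - coord k (climb i c hc v t)| ≤ t - s := by
    intro k s t hst hs ht
    rcases ht.eq_or_lt with rfl | ht
    · rcases hst.eq_or_lt with rfl | hst
      · simp
      · rw [climb_of_lt hc hs hst, climb_of_ge hc le_rfl]
        simp only [sub_self, mul_zero]
        refine (coord_comb_sub_ray_le k _ _ _).trans (le_of_eq (by ring))
    · rw [climb_of_lt hc hs (hst.trans_lt ht), climb_of_lt hc (hs.trans hst) ht]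
      refine (coord_comb_sub_le k _ _ _ _).trans (le_of_eq ?_)
      rw [abs_sub_comm, abs_of_nonneg] <;> linarith
  have h3 : ∀ k s t, s ≤ t → 1 + c / 2 ≤ s →
      |coord k (climb i c hc v s) - coord k (climb i c hc v t)| ≤ t - s := by
    intro k s t hst hs
    rw [climb_of_ge hc hs, climb_of_ge hc (hs.trans hst)]
    refine (coord_ray_sub_le k _ _).trans ?_
    rw [← mul_sub, abs_mul, NNReal.abs_eq, abs_sub_comm, abs_of_nonneg (by linarith)]
    nlinarith
  have h4 : ∀ k s t, s ≤ t → c ≤ s →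
      |coord k (climb i c hc v s) - coord k (climb i c hc v t)| ≤ t - s := by
    intro k s t hst hs
    rcases le_total t (1 + c / 2) with ht | ht
    · exact h2 k s t hst hs ht
    rcases le_total (1 + c / 2) s with hs' | hs'
    · exact h3 k s t hst hs'
    have := abs_sub_le (coord k (climb i c hc v s)) (coord k (climb i c hc v (1 + c / 2)))
      (coord k (climb i c hc v t))
    linarith [h2 k s _ hs' hs le_rfl, h3 k _ t ht le_rfl]
  have h5 : ∀ k s t, s ≤ t →
      |coord k (climb i c hc v s) - coord k (climb i c hc v t)| ≤ t - s := by
    intro k s t hst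
    rcases le_total t c with ht | ht
    · exact h1 k s t hst ht
    rcases le_total c s with hs | hs
    · exact h4 k s t hst hs
    have := abs_sub_le (coord k (climb i c hc v s)) (coord k (climb i c hc v c))
      (coord k (climb i c hc v t))
    linarith [h1 k s _ hs le_rfl, h4 k _ t ht le_rfl]
  intro k s t
  rcases le_total s t with h | h
  · rw [abs_sub_comm s t, abs_of_nonneg (sub_nonneg.2 h)]
    exact (h5 k (a + s) (a + t) (by linarith)).trans (by linarith)
  · rw [abs_of_nonneg (sub_nonneg.2 h), abs_sub_comm]
    exact (h5 k (a + t) (a + s) (by linarith)).trans (by linarith)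

lemma coord_depth_spine {i : Bool} {s : ℝ} (h : -1 ≤ s) (h' : s ≤ 1) :
    coord .depth (spine i s) = 1 - s / 2 := by
  rw [spine_eq ⟨h, h', le_rfl, by linarith⟩]
  simp [coord]

lemma coord_depth_climb {i : Bool} {c : ℝ} (hc) {v : ℝ≥0} {s : ℝ} (h : c ≤ s)
    (hv : v = 1 ∨ s ≤ 1 + c / 2) : coord .depth (climb i c hc v s) = 1 + c / 2 - s := by
  rcases lt_or_ge s (1 + c / 2) with hs | hs
  · rw [climb_of_lt hc h hs]
    simp only [coord]
    ring
  · rw [climb_of_ge hc hs]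
    rcases hv with rfl | hv
    · simp [coord]
    · simp [coord, le_antisymm hv hs]

lemma eq_ray_of_depth_eq_zero {p : Net} (h : coord .depth p = 0) : p = ray 0 le_rfl := by
  cases p with
  | ray r hr =>
    obtain rfl : r = 0 := by simpa [coord] using h
    rfl
  | comb i x y hx hT =>
    simp only [coord] at h
    linarith [hx.2.2.2]

lemma side_pos {l : ℝ → Net} (hl : Slow l) {i : Bool} {S : ℝ}
    (h0 : 0 < combSign i * coord .side (l 0))
    (hS : ∀ t, 0 ≤ t → t ≤ S → 0 < coord .depth (l t)) {t : ℝ} (ht : 0 ≤ t) (htS : t ≤ S) :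
    0 < combSign i * coord .side (l t) := by
  by_contra! h
  have hc : Continuous fun t => combSign i * coord .side (l t) :=
    continuous_const.mul (hl.continuous .side)
  obtain ⟨z, hz0, hzt, hz⟩ := exists_eq_zero hc ht
    (mul_nonpos_of_nonneg_of_nonpos h0.le h)
  have hd := hS z hz0 (hzt.trans htS)
  revert hz hd
  cases l z with
  | ray r hr => simp only [coord]; intros; linarith
  | comb j x h hx hT =>
    simp only [coord]
    intro hz hd
    have : 0 < (x + 2) * (1 - x / 2 - h) / 3 := by
      have : 0 < x + 2 := by linarith [hx.1]
      positivity
    rcases combSign_cases i with h | h <;> rcases combSign_cases j with h' | h' <;>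
      rw [h, h'] at hz <;> linarith

lemma eq_comb_of_side_pos {p : Net} {i : Bool} (h : 0 < combSign i * coord .side p) :
    ∃ x h hx hT, p = comb i x h hx hT := by
  cases p with
  | ray r hr => simp [coord] at h
  | comb j x y hx hT =>
    have : 0 < (x + 2) * (1 - x / 2 - y) / 3 := by
      have : 0 < x + 2 := by linarith [hx.1]
      have : 0 < 1 - x / 2 - y := by linarith [hx.2.2.2]
      positivity
    have : i = j := by
      simp only [coord] at h
      revert h
      cases i <;> cases j <;> simp [combSign] <;> linarith
    subst this
    exact ⟨x, y, hx, hT, rfl⟩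

lemma side_spine_pos (i : Bool) {s : ℝ} (h : -1 ≤ s) (h' : s ≤ 1) :
    1 / 4 < combSign i * coord .side (spine i s) := by
  rw [spine_eq ⟨h, h', le_rfl, by linarith⟩]
  simp only [coord]
  rcases combSign_cases i with hi | hi <;> rw [hi] <;> nlinarith

lemma eq_comb_of_near {l : ℝ → Net} (hl : Slow l) {i : Bool} {a s t : ℝ} (h : l s = spine i a)
    (ha : -1 ≤ a) (ha' : a ≤ 1) (hst : s ≤ t) (ht : t ≤ s + 1 / 4) :
    ∃ x h hx hT, l t = comb i x h hx hT := by
  have h1 := hl.le .side hst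
  have h2 := side_spine_pos i ha ha'
  rw [← h] at h2
  rw [abs_le] at h1
  apply eq_comb_of_side_pos
  rcases combSign_cases i with hi | hi <;> rw [hi] at h2 ⊢ <;> linarith [h1.1, h1.2]

/-- A curve starting at the bottom of a comb has, at some early time in a dense set, either fallen
behind or stayed at the front of the spine. -/
lemma exists_late_or_front {i : Bool} {l : ℝ → Net} (hl : Slow l) (h0 : l 0 = spine i 0)
    {P : ℝ → Prop} (hP : ∀ a b : ℝ, a < b → ∃ c, P c ∧ a < c ∧ c < b) :
    ∃ c, P c ∧ 0 < c ∧ c ≤ 1 / 4 ∧ (1 - c / 2 < coord .depth (l c) ∨ l c = spine i c) := by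
  by_cases hg : ∃ t, 0 < t ∧ t ≤ 1 / 4 ∧ 1 - t / 2 < coord .depth (l t)
  · obtain ⟨t, ht0, ht, hg⟩ := hg
    obtain ⟨c, hc, h1, h2⟩ := hP (max 0 (t - (coord .depth (l t) - (1 - t / 2)) / 2)) t
      (max_lt ht0 (by linarith))
    obtain ⟨h3, h4⟩ := max_lt_iff.1 h1
    refine ⟨c, hc, h3, by linarith, Or.inl ?_⟩
    have := (abs_le.1 (hl.le .depth h2.le)).2
    linarith
  push Not at hg
  have hs0 := spine_eq (i := i) (s := 0) ⟨by norm_num, by norm_num, by norm_num, by norm_num⟩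
  have key : ∀ t, 0 < t → t ≤ 1 / 4 → ∃ x h hx hT, l t = comb i x h hx hT ∧ 0 < x ∧
      x + h ≤ t ∧ t ≤ x + 2 * h := by
    intro t ht0 ht
    obtain ⟨x, h, hx, hT, e⟩ := eq_comb_of_near hl h0 (by norm_num) (by norm_num) ht0.le
      (by linarith)
    have hd := hg t ht0 ht
    have h1 := hl.le (.tooth i 0) ht0.le
    have h2 := hl.le .depth ht0.le
    rw [h0, hs0, e] at h1 h2
    rw [e] at hd
    have hT' : h = 0 ∨ 0 < x := hT.imp_right (·.1)
    simp only [coord] at hd h1 h2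
    refine ⟨x, h, hx, hT, e, ?_⟩
    grind
  have front : ∃ b, 0 < b ∧ b ≤ 1 / 4 ∧ l b = spine i b := by
    obtain ⟨x, h, hx, hT, e, hx0, h1, h2⟩ := key (1 / 4) (by norm_num) le_rfl
    rcases hx.2.2.1.eq_or_lt with rfl | hh
    · obtain rfl : x = 1 / 4 := by linarith
      exact ⟨_, hx0, le_rfl, e.trans (spine_eq hx).symm⟩
    · obtain ⟨z, hz0, hz1, hz⟩ := exists_eq_zero (hl.continuous (.tooth i x))
        (show (0 : ℝ) ≤ 1 / 4 by norm_num) (by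
          rw [h0, hs0, e]
          simp only [coord, if_true, if_neg hx0.ne]
          apply mul_nonpos_of_nonpos_of_nonneg <;> grind)
      have hz0' : 0 < z := by
        refine hz0.lt_of_ne ?_
        rintro rfl
        rw [h0, hs0] at hz
        simp only [coord, if_true, if_neg hx0.ne] at hz
        grind
      obtain ⟨y, g, hy, hT', e', hy0, h3, h4⟩ := key z hz0' hz1
      rw [e'] at hz
      simp only [coord, if_true] at hz
      obtain rfl : y = x := by grind
      obtain rfl : g = 0 := by grind
      obtain rfl : z = y := by linarith
      exact ⟨z, hz0', hz1, e'.trans (spine_eq hy).symm⟩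
  obtain ⟨b, hb0, hb, hlb⟩ := front
  rw [spine_eq ⟨by linarith, by linarith, le_rfl, by linarith⟩] at hlb
  obtain ⟨c, hc, hc0, hcb⟩ := hP 0 b hb0
  refine ⟨c, hc, hc0, by linarith, Or.inr ?_⟩
  obtain ⟨x, h, hx, hT, e, hx0, h1, h2⟩ := key c hc0 (by linarith)
  have h3 := hl.le (.tooth i b) hcb.le
  rw [hlb, e] at h3
  simp only [coord, if_true] at h3
  obtain ⟨rfl, rfl⟩ : h = 0 ∧ x = c := by grind
  rw [e, spine_eq hx]

/-- A curve that is late, or is on the spine at a position without a tooth, does not reach the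
ray as early as a curve climbing the tooth there. -/
lemma depth_pos_of_late {i : Bool} {l : ℝ → Net} (hl : Slow l) (h0 : l 0 = spine i 0) {c : ℝ}
    (hc0 : 0 < c) (hc : c ≤ 1 / 4)
    (h : 1 - c / 2 < coord .depth (l c) ∨ l c = spine i c ∧ ¬ HasTooth i c)
    {t : ℝ} (ht0 : 0 ≤ t) (ht : t ≤ 1 + c / 2) : 0 < coord .depth (l t) := by
  rcases lt_or_ge t 1 with ht1 | ht1
  · have h1 := (abs_le.1 (hl.le .depth ht0)).1
    rw [h0, coord_depth_spine (by norm_num) (by norm_num)] at h1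
    linarith
  rcases h with h | ⟨h, hcT⟩
  · have h1 := (abs_le.1 (hl.le .depth (show c ≤ t by linarith))).1
    linarith
  by_contra! hd
  obtain ⟨x, y, hx, hT, e⟩ := eq_comb_of_near hl h (by linarith) (by linarith)
    (show c ≤ c + 1 / 4 by linarith) le_rfl
  have h1 := (abs_le.1 (hl.le .depth (show c + 1 / 4 ≤ t by linarith))).1
  have h2 := (abs_le.1 (hl.le .depth (show c ≤ c + 1 / 4 by linarith))).1
  have h3 := hl.le (.tooth i c) (show c ≤ c + 1 / 4 by linarith)
  rw [spine_eq ⟨by linarith, by linarith, le_rfl, by linarith⟩] at h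
  rw [h, e] at h2 h3
  replace h1 : coord .depth (l (c + 1 / 4)) ≤ t - (c + 1 / 4) := by linarith
  rw [e] at h1
  simp only [coord, if_true] at h1 h2 h3
  have hT' : x = c → y = 0 := fun hxc => hT.resolve_right (hxc ▸ hcT)
  grind

lemma exists_hasTooth (i : Bool) {a b : ℝ} (hab : a < b) :
    ∃ c, (0 < c → HasTooth i c) ∧ a < c ∧ c < b := by
  cases i with
  | true =>
    obtain ⟨c, hc, h1, h2⟩ := exists_irrational_btwn hab
    exact ⟨c, fun h => ⟨h, by simpa⟩, h1, h2⟩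
  | false =>
    obtain ⟨c, h1, h2⟩ := exists_rat_btwn hab
    exact ⟨c, fun h => ⟨h, by simp⟩, h1, h2⟩

lemma not_hasTooth {i : Bool} {c : ℝ} (h : HasTooth i c) : ¬ HasTooth (!i) c := by
  rintro ⟨-, h'⟩
  have := h.2
  cases i <;> simp_all

lemma isPath_spine (i : Bool) (a : ℝ) : IsPath (spine i a) fun t : ℝ≥0 => spine i (a + t) := by
  simpa using (slow_spine i a).isPath

lemma isPath_climb {i : Bool} {c : ℝ} (hc) {v : ℝ≥0} (hv : v ≤ 1) {a : ℝ} (ha : a ≤ c) :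
    IsPath (spine i a) fun t : ℝ≥0 => climb i c hc v (a + t) := by
  have := (slow_climb hc hv a).isPath
  rwa [add_zero, climb_of_le hc ha] at this

theorem exists_escape
    {Φ : (ℝ≥0 → Net) → (ℝ≥0 → Net) × (ℝ≥0 → Net)}
    (hΦ : IsLionTeamStrategy (spine true 0) (spine false (-1)) (spine false 0) Φ) :
    ∃ m, IsPath (spine false 0) m ∧ ∀ t : ℝ≥0, (Φ m).1 t ≠ m t ∧ (Φ m).2 t ≠ m t := by
  have hw := isPath_spine false 0
  obtain ⟨c, hcT, hc0, hc, hl⟩ := exists_late_or_front (hΦ.1 _ hw).1.slow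
    (by simpa using (hΦ.1 _ hw).1.1) (fun a b hab => exists_hasTooth false hab)
  have hcT := hcT hc0
  have hc' : HasTooth false c ∧ c ≤ 1 := ⟨hcT, by linarith⟩
  have hm := isPath_climb hc' (v := 1) le_rfl hc0.le
  refine ⟨_, hm, fun t => ?_⟩
  have hagree := (hΦ.2 _ _ hw hm c.toNNReal (fun s hs => by
    have hs : (s : ℝ) ≤ c := by
      rwa [← NNReal.coe_le_coe, Real.coe_toNNReal _ hc0.le] at hs
    simp only [zero_add]
    rw [climb_of_le hc' hs]) _ le_rfl).1
  obtain ⟨⟨h10, -⟩, ⟨h20, -⟩⟩ := hΦ.1 _ hm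
  have hl1 := (hΦ.1 _ hm).1.slow
  have hl2 := (hΦ.1 _ hm).2.slow
  simp only [zero_add] at hl hagree h10 h20 hl1 hl2 ⊢
  rw [hagree] at hl
  generalize Φ (fun t : ℝ≥0 => climb false c hc' 1 t) = l at *
  have hl0 : l.1 (Real.toNNReal 0) = spine true 0 := by simpa using h10
  have hpos : ∀ s : ℝ, 0 ≤ s → s ≤ 1 + c / 2 → 0 < coord .depth (l.1 s.toNNReal) :=
    fun s => depth_pos_of_late hl1 hl0 hc0 hc
      (hl.imp_right fun h => ⟨h, not_hasTooth hcT⟩)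
  have htt : (t : ℝ).toNNReal = t := Real.toNNReal_coe
  constructor
  · intro heq
    rcases le_or_gt (t : ℝ) (1 + c / 2) with ht | ht
    · have hside := side_pos hl1 (i := true) (by
        rw [hl0]
        linarith [side_spine_pos true (show (-1 : ℝ) ≤ 0 by norm_num) zero_le_one])
        hpos t.2 ht
      have hside := eq_comb_of_side_pos hside
      rw [show Real.toNNReal t.1 = t from htt, heq] at hside
      obtain ⟨x, h, hx, hT, e⟩ := hside
      rcases le_or_gt (t : ℝ) c with htc | htc
      · rw [climb_of_le hc' htc, spine] at e
        simp at e
      rcases lt_or_ge (t : ℝ) (1 + c / 2) with hts | hts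
      · rw [climb_of_lt hc' htc.le hts] at e
        simp at e
      · rw [climb_of_ge hc' hts] at e
        simp at e
    · have h1 := hpos (1 + c / 2) (by linarith) le_rfl
      have h2 := (abs_le.1 (hl1.le .depth ht.le)).1
      rw [htt, heq, coord_depth_climb hc' (by linarith) (Or.inl rfl)] at h2
      linarith
  · intro heq
    have h2 := (abs_le.1 (hl2.le .depth t.2)).1
    rw [show Real.toNNReal t.1 = t from htt, heq, Real.toNNReal_zero, h20,
      coord_depth_spine le_rfl (by norm_num)] at h2
    rcases le_or_gt (t : ℝ) c with htc | htc
    · rw [climb_of_le hc' htc,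
        coord_depth_spine (by linarith [t.2]) (by linarith)] at h2
      change -((t : ℝ) - 0) ≤ _ at h2
      linarith
    · rw [coord_depth_climb hc' htc.le (Or.inl rfl)] at h2
      change -((t : ℝ) - 0) ≤ _ at h2
      linarith

theorem exists_capture
    {Ψ : (ℝ≥0 → Net) × (ℝ≥0 → Net) → (ℝ≥0 → Net)}
    (hΨ : IsManStrategyVsTwo (spine true 0) (spine false (-1)) (spine false 0) Ψ) :
    ∃ l : (ℝ≥0 → Net) × (ℝ≥0 → Net), IsPath (spine true 0) l.1 ∧ IsPath (spine false (-1)) l.2 ∧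
      ∃ t : ℝ≥0, Ψ l t = l.1 t ∨ Ψ l t = l.2 t := by
  by_contra! hfree
  have hΨ1 : ∀ a b, IsPath (spine true 0) a → IsPath (spine false (-1)) b →
      IsPath (spine false 0) (Ψ (a, b)) := fun a b => hΨ.1 (a, b)
  have hΨ2 : ∀ a b a' b', IsPath (spine true 0) a → IsPath (spine false (-1)) b →
      IsPath (spine true 0) a' → IsPath (spine false (-1)) b' → ∀ t : ℝ≥0,
      (∀ s ≤ t, a s = a' s ∧ b s = b' s) → ∀ s ≤ t, Ψ (a, b) s = Ψ (a', b') s :=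
    fun a b a' b' => hΨ.2 (a, b) (a', b')
  have hfree' : ∀ a b, IsPath (spine true 0) a → IsPath (spine false (-1)) b → ∀ t : ℝ≥0,
      Ψ (a, b) t ≠ a t ∧ Ψ (a, b) t ≠ b t := fun a b => hfree (a, b)
  have hw1 := isPath_spine true 0
  have hw2 := isPath_spine false (-1)
  obtain ⟨y, hyT, hy0, hy, hm⟩ := exists_late_or_front (hΨ1 _ _ hw1 hw2).slow
    (by simpa using (hΨ1 _ _ hw1 hw2).1) (fun a b hab => exists_hasTooth true hab)
  have hyT := hyT hy0
  have hy' : HasTooth true y ∧ y ≤ 1 := ⟨hyT, by linarith⟩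
  have hc1 := isPath_climb hy' (v := 0) zero_le_one hy0.le
  have hlate : 1 - y / 2 ≤ coord .depth
      (Ψ (fun t : ℝ≥0 => spine true (0 + t), fun t : ℝ≥0 => spine false (-1 + t)) y.toNNReal) := by
    rcases hm with hm | hm
    · exact hm.le
    · rw [hm, coord_depth_spine (by linarith) (by linarith)]
  have confined : ∀ l₂, IsPath (spine false (-1)) l₂ →
      (∀ s : ℝ≥0, (s : ℝ) ≤ y → l₂ s = spine false (-1 + s)) → ∀ t : ℝ, 0 ≤ t →
      0 < coord .depth (Ψ (fun t : ℝ≥0 => climb true y hy' 0 (0 + t), l₂) t.toNNReal) := by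
    intro l₂ hl₂ hagree t ht
    have hsl := (hΨ1 _ _ hc1 hl₂).slow
    have h0 := (hΨ1 _ _ hc1 hl₂).1
    have hy2 := hΨ2 _ _ _ _ hw1 hw2 hc1 hl₂ y.toNNReal (fun s hs => by
      have hs : (s : ℝ) ≤ y := by
        rwa [← NNReal.coe_le_coe, Real.coe_toNNReal _ hy0.le] at hs
      simp only [zero_add]
      rw [climb_of_le hy' hs, hagree s hs]
      exact ⟨rfl, rfl⟩) _ le_rfl
    rw [hy2] at hlate
    by_contra! hneg
    obtain ⟨z, hz0, -, hz⟩ := exists_eq_zero (hsl.continuous .depth) ht (by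
      simp only [Real.toNNReal_zero]
      rw [h0, coord_depth_spine (by norm_num) (by norm_num)]
      linarith)
    have hzy : 1 + y / 2 ≤ z := by
      have h1 := (abs_le.1 (hsl.le .depth hz0)).1
      simp only [Real.toNNReal_zero] at h1
      rw [h0, hz, coord_depth_spine (by norm_num) (by norm_num)] at h1
      have h2 := (abs_le.1 (hsl.le .depth (show y ≤ z by linarith))).1
      rw [hz] at h2
      linarith
    refine (hfree' _ _ hc1 hl₂ z.toNNReal).1 ?_
    rw [eq_ray_of_depth_eq_zero hz]
    simp only [zero_add, Real.coe_toNNReal _ hz0]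
    rw [climb_of_ge hy' hzy]
    simp
  have on_comb : ∀ l₂, IsPath (spine false (-1)) l₂ →
      (∀ s : ℝ≥0, (s : ℝ) ≤ y → l₂ s = spine false (-1 + s)) → ∀ t : ℝ, 0 ≤ t →
      ∃ x h hx hT, Ψ (fun t : ℝ≥0 => climb true y hy' 0 (0 + t), l₂) t.toNNReal
        = comb false x h hx hT := by
    intro l₂ hl₂ hagree t ht
    refine eq_comb_of_side_pos (side_pos (hΨ1 _ _ hc1 hl₂).slow ?_
      (fun s hs _ => confined l₂ hl₂ hagree s hs) ht le_rfl)
    simp only [Real.toNNReal_zero]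
    rw [(hΨ1 _ _ hc1 hl₂).1]
    linarith [side_spine_pos false (show (-1 : ℝ) ≤ 0 by norm_num) zero_le_one]
  have hsl := (hΨ1 _ _ hc1 hw2).slow
  have h0 := (hΨ1 _ _ hc1 hw2).1
  have hsweep : ∃ τ : ℝ, 0 ≤ τ ∧ ∃ x h hx hT, Ψ (fun t : ℝ≥0 => climb true y hy' 0 (0 + t),
      fun t : ℝ≥0 => spine false (-1 + t)) τ.toNNReal = comb false x h hx hT ∧ τ = 1 + x := by
    have hcont : Continuous fun t : ℝ => 3 * (combSign false * coord .side
        (Ψ (fun t : ℝ≥0 => climb true y hy' 0 (0 + t),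
          fun t : ℝ≥0 => spine false (-1 + t)) t.toNNReal)) - (1 + t) * coord .depth
        (Ψ (fun t : ℝ≥0 => climb true y hy' 0 (0 + t),
          fun t : ℝ≥0 => spine false (-1 + t)) t.toNNReal) :=
      (continuous_const.mul (continuous_const.mul (hsl.continuous .side))).sub
        ((continuous_const.add continuous_id).mul (hsl.continuous .depth))
    have hval : ∀ x h hx hT, 3 * (combSign false * coord .side (comb false x h hx hT))
        = (x + 2) * (1 - x / 2 - h) := by
      intro x h hx hT
      simp only [coord, combSign]
      norm_num
      ring
    obtain ⟨τ, hτ0, -, hτ⟩ := exists_eq_zero hcont (show (0 : ℝ) ≤ 2 by norm_num) (by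
      apply mul_nonpos_of_nonneg_of_nonpos
      · simp only [Real.toNNReal_zero]
        rw [h0, spine_eq ⟨by norm_num, by norm_num, le_rfl, by norm_num⟩, hval]
        norm_num [coord]
      · obtain ⟨x, h, hx, hT, e⟩ := on_comb _ hw2 (fun _ _ => rfl) 2 (by norm_num)
        rw [e, hval]
        simp only [coord]
        nlinarith [hx.2.1, hx.2.2.2])
    obtain ⟨x, h, hx, hT, e⟩ := on_comb _ hw2 (fun _ _ => rfl) τ hτ0
    refine ⟨τ, hτ0, x, h, hx, hT, e, ?_⟩
    simp only [e] at hτ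
    rw [hval] at hτ
    simp only [coord] at hτ
    have : (x + 1 - τ) * (1 - x / 2 - h) = 0 := by linarith
    rcases mul_eq_zero.1 this with h | h <;> linarith [hx.2.2.2]
  obtain ⟨τ, hτ0, x, h, hx, hT, e, rfl⟩ := hsweep
  have hh : h ≠ 0 := by
    rintro rfl
    refine (hfree' _ _ hc1 hw2 _).2 (e.trans ?_)
    simp only [Real.coe_toNNReal _ hτ0]
    rw [← spine_eq]
    congr 1
    ring
  have hxT := hT.resolve_left hh
  have hx' : HasTooth false x ∧ x ≤ 1 := ⟨hxT, hx.2.1⟩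
  have hx0 : 0 < x := hxT.1
  have hc2 := isPath_climb hx' (v := 0) zero_le_one (show (-1 : ℝ) ≤ x by linarith)
  have hagree : ∀ s : ℝ≥0, (s : ℝ) ≤ 1 + x → climb false x hx' 0 (-1 + s) = spine false (-1 + s) :=
    fun s hs => climb_of_le hx' (by linarith)
  have hagree' : ∀ s : ℝ≥0, (s : ℝ) ≤ y → climb false x hx' 0 (-1 + s) = spine false (-1 + s) :=
    fun s hs => hagree s (by linarith)
  have e' : Ψ (fun t : ℝ≥0 => climb true y hy' 0 (0 + t),
      fun t : ℝ≥0 => climb false x hx' 0 (-1 + t)) (1 + x).toNNReal = comb false x h hx hT := by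
    rw [← e]
    refine hΨ2 _ _ _ _ hc1 hc2 hc1 hw2 _ (fun s hs => ⟨rfl, hagree s ?_⟩) _ le_rfl
    rwa [← NNReal.coe_le_coe, Real.coe_toNNReal _ hτ0] at hs
  have hsl' := (hΨ1 _ _ hc1 hc2).slow
  have hcont : Continuous fun t : ℝ => min
      (coord (.tooth false x) (Ψ (fun t : ℝ≥0 => climb true y hy' 0 (0 + t),
        fun t : ℝ≥0 => climb false x hx' 0 (-1 + t)) t.toNNReal))
      (coord .depth (climb false x hx' 0 (-1 + t)) - coord .depth
        (Ψ (fun t : ℝ≥0 => climb true y hy' 0 (0 + t),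
          fun t : ℝ≥0 => climb false x hx' 0 (-1 + t)) t.toNNReal)) :=
    (hsl'.continuous _).min
      (((slow_climb hx' zero_le_one (-1)).continuous .depth).sub (hsl'.continuous .depth))
  obtain ⟨z, hz1, hz2, hz⟩ := exists_eq_zero hcont (show 1 + x ≤ 2 + x / 2 by linarith [hx.2.1]) (by
    apply mul_nonpos_of_nonneg_of_nonpos
    · simp only [e']
      rw [coord_depth_climb hx' (by linarith) (Or.inr (by linarith [hx.2.1]))]
      simp only [coord, if_true]
      grind
    · refine (min_le_right _ _).trans ?_
      have := confined _ hc2 hagree' (2 + x / 2) (by linarith)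
      rw [coord_depth_climb hx' (by linarith [hx.2.1]) (Or.inr (by linarith))]
      linarith)
  obtain ⟨x', h', hx1, hT1, e1⟩ := on_comb _ hc2 hagree' z (by linarith)
  simp only [e1] at hz
  rw [coord_depth_climb hx' (by linarith) (Or.inr (by linarith))] at hz
  simp only [coord, if_true] at hz
  have hxx := abs_nonneg (x' - x)
  have hxx' : x' ≠ x → 0 < |x' - x| := fun h => abs_pos.2 (sub_ne_zero.2 h)
  obtain rfl : x' = x := by grind
  have hh' : h' = -1 + z - x' := by grind
  refine (hfree' _ _ hc1 hc2 z.toNNReal).2 (e1.trans ?_)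
  simp only [Real.coe_toNNReal z (by linarith)]
  rw [climb_of_lt hx' (by linarith) (by linarith [hx1.2.2.2])]
  simp [hh']

end Net

/-- There is a metric space `Y` with starting points `y₁`, `y₂` for two lions and `yM`
for the man such that neither side has a winning strategy in the two-lions-versus-man
pursuit game on `Y`. -/
theorem two_lions_one_man_no_winner :
    ∃ (Y : Type) (i : MetricSpace Y) (y₁ y₂ yM : Y),
      @TwoLionsNoWinner Y i y₁ y₂ yM := by
  exact ⟨Net, inferInstance, .spine true 0, .spine false (-1), .spine false 0,
    fun _ => Net.exists_escape, fun _ => Net.exists_capture⟩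

end
end
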